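/- For every finite group G and every integer n ≥ 0, α(G × C₂ⁿ) = α(G), where C₂ⁿ denotes the direct product of n copies of the cyclic group of order 2. -/

import Mathlib

open scoped Classical

/-- The number of cyclic subgroups of a group. -/
noncomputable def numCyclic (G : Type*) [Group G] : ℕ :=
  Nat.card {H : Subgroup G // IsCyclic (↥H)}

/-- `alpha G = c(G) / |G|`, the number of cyclic subgroups divided by the order. -/
noncomputable def alpha (G : Type*) [Group G] : ℚ :=
  (numCyclic G : ℚ) / (Nat.card G : ℚ)

/-- In a finite group, a cyclic subgroup `H` has `φ |H|` generators. -/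
theorem card_filter_zpowers_eq {G : Type*} [Group G] [Fintype G] (H : Subgroup G) (hH : IsCyclic H) :
    (Finset.univ.filter fun g : G => Subgroup.zpowers g = H).card = Nat.totient (Nat.card H) := by
  rw [Nat.card_eq_fintype_card, ← IsCyclic.card_orderOf_eq_totient (α := H) dvd_rfl]
  symm
  refine Finset.card_bij (fun x _ => (x : G)) ?_ (fun _ _ _ _ h => Subtype.ext h) ?_
  · intro x hx
    simp only [Finset.mem_filter, Finset.mem_univ, true_and] at hx ⊢
    refine Subgroup.eq_of_le_of_card_ge ((Subgroup.zpowers_le).2 x.2) ?_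
    rw [Nat.card_zpowers, Subgroup.orderOf_coe, hx, Nat.card_eq_fintype_card]
  · intro g hg
    simp only [Finset.mem_filter, Finset.mem_univ, true_and] at hg
    refine ⟨⟨g, hg ▸ Subgroup.mem_zpowers g⟩, ?_, rfl⟩
    simp only [Finset.mem_filter, Finset.mem_univ, true_and]
    rw [Subgroup.orderOf_mk, ← Nat.card_zpowers, hg, Nat.card_eq_fintype_card]

/-- The number of cyclic subgroups is the sum of `1 / φ (orderOf g)` over the group elements. -/
theorem numCyclic_eq_sum (G : Type*) [Group G] [Fintype G] :
    (numCyclic G : ℚ) = ∑ g : G, ((Nat.totient (orderOf g) : ℕ) : ℚ)⁻¹ := by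
  let f : G → {H : Subgroup G // IsCyclic H} := fun g => ⟨Subgroup.zpowers g, inferInstance⟩
  rw [← Finset.sum_fiberwise Finset.univ f, numCyclic, Nat.card_eq_fintype_card]
  symm
  calc _ = ∑ _H : {H : Subgroup G // IsCyclic H}, (1 : ℚ) := by
        refine Finset.sum_congr rfl fun H _ => ?_
        have hcongr : ∀ g ∈ Finset.univ.filter (fun g => f g = H),
            ((Nat.totient (orderOf g) : ℕ) : ℚ)⁻¹ = ((Nat.totient (Nat.card H.1) : ℕ) : ℚ)⁻¹ := by
          intro g hg
          have hg' : Subgroup.zpowers g = H.1 := congrArg Subtype.val (Finset.mem_filter.1 hg).2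
          rw [← Nat.card_zpowers, hg']
        have hcard : (Finset.univ.filter fun g => f g = H).card = Nat.totient (Nat.card H.1) := by
          rw [← card_filter_zpowers_eq H.1 H.2]
          congr 1
          ext g
          simp [f, Subtype.ext_iff]
        rw [Finset.sum_congr rfl hcongr, Finset.sum_const, hcard, nsmul_eq_mul]
        have : 0 < Nat.totient (Nat.card H.1) := Nat.totient_pos.2 Nat.card_pos
        exact mul_inv_cancel₀ (by positivity)
    _ = _ := by simp

theorem totient_lcm_of_dvd_two {m k : ℕ} (hk : k ∣ 2) :
    Nat.totient (Nat.lcm m k) = Nat.totient m := by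
  rcases (Nat.dvd_prime Nat.prime_two).1 hk with rfl | rfl
  · simp
  · rcases Nat.even_or_odd m with hm | hm
    · rw [Nat.lcm_eq_left hm.two_dvd]
    · have hc : Nat.Coprime m 2 := Nat.coprime_two_right.2 hm
      rw [hc.lcm_eq_mul, Nat.totient_mul hc, Nat.totient_two, mul_one]

/-- `alpha` is unchanged by a direct factor of exponent dividing `2`. -/
theorem alpha_prod_of_sq_eq_one (G E : Type*) [Group G] [Fintype G] [Group E] [Fintype E]
    (hE : ∀ v : E, v ^ 2 = 1) : alpha (G × E) = alpha G := by
  have hsum : (numCyclic (G × E) : ℚ) = numCyclic G * Nat.card E := by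
    rw [numCyclic_eq_sum, numCyclic_eq_sum, Fintype.sum_prod_type, Finset.sum_mul]
    refine Finset.sum_congr rfl fun g _ => ?_
    simp [Prod.orderOf, totient_lcm_of_dvd_two (orderOf_dvd_of_pow_eq_one (hE _)), mul_comm]
  have hpos : (Nat.card E : ℚ) ≠ 0 := by exact_mod_cast Nat.card_pos.ne'
  rw [alpha, alpha, hsum, Nat.card_prod, Nat.cast_mul, mul_div_mul_right _ _ hpos]

theorem stmt_5 (G : Type*) [Group G] [Fintype G] (n : ℕ) :
    alpha (G × (Fin n → Multiplicative (ZMod 2))) = alpha G := by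
  refine alpha_prod_of_sq_eq_one G _ fun v => funext fun i => ?_
  have h : ∀ x : Multiplicative (ZMod 2), x ^ 2 = 1 := by decide
  exact h (v i)
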